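/- If A is a Gelfand residuated lattice (every prime filter of A is included in a unique maximal filter of A), then Rad(A) has the Boolean Lifting Property. -/

import Mathlib

/-- A (commutative integral bounded) residuated lattice: a bounded lattice together
with a commutative monoid structure (whose unit is the top element) and a residuum
operation satisfying the law of residuation. -/
class ResiduatedLattice (A : Type*) extends Lattice A, BoundedOrder A, CommMonoid A where
  rimp : A → A → A
  residuation : ∀ a b c : A, a ≤ rimp b c ↔ a * b ≤ c
  one_eq_top : (1 : A) = ⊤

namespace ResiduatedLattice

variable {A : Type*} [ResiduatedLattice A]

/-- Negation: ¬a = a → 0. -/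
def rneg (a : A) : A := rimp a ⊥

/-- Biresiduum: d(a,b) = (a → b) ∧ (b → a). -/
def bires (a b : A) : A := rimp a b ⊓ rimp b a

/-- Membership in the Boolean center B(A): complemented elements of the bounded lattice. -/
def IsBoolElem (e : A) : Prop := ∃ f : A, e ⊔ f = ⊤ ∧ e ⊓ f = ⊥

/-- A filter of a residuated lattice. -/
def IsRLFilter (F : Set A) : Prop :=
  F.Nonempty ∧ (∀ a b : A, a ∈ F → b ∈ F → a * b ∈ F) ∧ (∀ a b : A, a ∈ F → a ≤ b → b ∈ F)

/-- The principal filter [x) = {a | xⁿ ≤ a for some n ≥ 1}. -/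
def princ (x : A) : Set A := {a : A | ∃ n : ℕ, 1 ≤ n ∧ x ^ n ≤ a}

/-- A filter F has the Boolean Lifting Property. -/
def HasBLP (F : Set A) : Prop :=
  ∀ a : A, a ⊔ rneg a ∈ F → ∃ e : A, IsBoolElem e ∧ bires a e ∈ F

/-- A filter F has the Idempotent Lifting Property. -/
def HasILP (F : Set A) : Prop :=
  ∀ a : A, bires a (a * a) ∈ F → ∃ e : A, e * e = e ∧ bires a e ∈ F

/-- A proper filter. -/
def IsProperRLFilter (F : Set A) : Prop := IsRLFilter F ∧ F ≠ Set.univ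

/-- A maximal filter: a proper filter maximal under inclusion among proper filters. -/
def IsMaxRLFilter (M : Set A) : Prop :=
  IsProperRLFilter M ∧ ∀ G : Set A, IsProperRLFilter G → M ⊆ G → G = M

/-- A prime filter: a proper filter P with a ∨ b ∈ P → a ∈ P or b ∈ P. -/
def IsPrimeRLFilter (P : Set A) : Prop :=
  IsProperRLFilter P ∧ ∀ a b : A, a ⊔ b ∈ P → a ∈ P ∨ b ∈ P

/-- The radical: intersection of all maximal filters. -/
def rad (A : Type*) [ResiduatedLattice A] : Set A :=
  {a : A | ∀ M : Set A, IsMaxRLFilter M → a ∈ M}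

/-- v(a) = set of maximal filters containing a. -/
def vset (a : A) : Set (Set A) := {M : Set A | IsMaxRLFilter M ∧ a ∈ M}

/-- d(a) = set of maximal filters not containing a. -/
def dset (a : A) : Set (Set A) := {M : Set A | IsMaxRLFilter M ∧ a ∉ M}

/-- An element is nilpotent iff some positive power of it is 0. -/
def RLNilpotent (a : A) : Prop := ∃ n : ℕ, 1 ≤ n ∧ a ^ n = ⊥

/-- The join F ∨ G of two filters: the smallest filter including F ∪ G. -/
def filtJoin (F G : Set A) : Set A := ⋂₀ {H : Set A | IsRLFilter H ∧ F ∪ G ⊆ H}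

end ResiduatedLattice

namespace ResiduatedLattice

section helpers

variable {A : Type*} [ResiduatedLattice A]

lemma h17_le_one (a : A) : a ≤ 1 := by rw [one_eq_top]; exact le_top

lemma h17_mul_right {a b : A} (c : A) (h : a ≤ b) : a * c ≤ b * c :=
  (residuation _ _ _).1 (h.trans ((residuation _ _ _).2 le_rfl))

lemma h17_mul {a b c d : A} (h : a ≤ b) (h' : c ≤ d) : a * c ≤ b * d := by
  refine (h17_mul_right c h).trans ?_
  rw [mul_comm b c, mul_comm b d]
  exact h17_mul_right b h'

lemma h17_mul_le_left (a b : A) : a * b ≤ a := by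
  simpa using h17_mul (le_refl a) (h17_le_one b)

lemma h17_mul_le_right (a b : A) : a * b ≤ b := by
  rw [mul_comm]; exact h17_mul_le_left b a

lemma h17_mul_sup {p a b c : A} (ha : p * a ≤ c) (hb : p * b ≤ c) : p * (a ⊔ b) ≤ c := by
  rw [mul_comm] at *
  exact (residuation _ _ _).1 (sup_le ((residuation _ _ _).2 ha)
    ((residuation _ _ _).2 hb))

lemma h17_pow (a b c : A) (n : ℕ) : ∀ (m : ℕ) (p : A), p * a ^ n ≤ c → p * b ^ m ≤ c →
    p * (a ⊔ b) ^ (n + m) ≤ c := by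
  induction n with
  | zero =>
    intro m p h _
    exact (h17_mul_le_left _ _).trans (by simpa using h)
  | succ n ihn =>
    intro m
    induction m with
    | zero =>
      intro p _ h
      exact (h17_mul_le_left _ _).trans (by simpa using h)
    | succ m ihm =>
      intro p h h'
      have e : p * (a ⊔ b) ^ (n + 1 + (m + 1)) = (p * (a ⊔ b) ^ (n + 1 + m)) * (a ⊔ b) := by
        rw [← add_assoc, pow_succ, mul_assoc]
      rw [e]
      apply h17_mul_sup
      · have := ihn (m + 1) (p * a) (by rw [mul_assoc, ← pow_succ']; exact h)
          ((h17_mul_right _ (h17_mul_le_left p a)).trans h')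
        rw [mul_right_comm, show n + 1 + m = n + (m + 1) by omega]
        exact this
      · have := ihm (p * b) ((h17_mul_right _ (h17_mul_le_left p b)).trans h)
          (by rw [mul_assoc, ← pow_succ']; exact h')
        rw [mul_right_comm]
        exact this

lemma h17_top_mem {F : Set A} (hF : IsRLFilter F) : (1 : A) ∈ F := by
  obtain ⟨x, hx⟩ := hF.1
  exact hF.2.2 x 1 hx (h17_le_one x)

lemma h17_pow_mem {F : Set A} (hF : IsRLFilter F) {a : A} (ha : a ∈ F) (n : ℕ) : a ^ n ∈ F := by
  induction n with
  | zero => simpa using h17_top_mem hF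
  | succ n ih => rw [pow_succ]; exact hF.2.1 _ _ ih ha

lemma h17_proper {F : Set A} (hF : IsRLFilter F) : F ≠ Set.univ ↔ ⊥ ∉ F := by
  constructor
  · intro h hb
    exact h (Set.eq_univ_of_forall fun x => hF.2.2 _ _ hb bot_le)
  · rintro h rfl
    exact h trivial

/-- Filter generated by `F` and `a`. -/
def h17adj (F : Set A) (a : A) : Set A := {z | ∃ p ∈ F, ∃ n : ℕ, p * a ^ n ≤ z}

lemma h17adj_filter {F : Set A} (hF : IsRLFilter F) (a : A) : IsRLFilter (h17adj F a) := by
  refine ⟨⟨1, 1, h17_top_mem hF, 0, h17_le_one _⟩, ?_, ?_⟩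
  · rintro x y ⟨p, hp, n, h⟩ ⟨q, hq, m, h'⟩
    refine ⟨p * q, hF.2.1 _ _ hp hq, n + m, ?_⟩
    rw [pow_add, mul_mul_mul_comm]
    exact h17_mul h h'
  · rintro x y ⟨p, hp, n, h⟩ hxy
    exact ⟨p, hp, n, h.trans hxy⟩

lemma h17adj_sub {F : Set A} (a : A) : F ⊆ h17adj F a := fun x hx =>
  ⟨x, hx, 0, by simp⟩

lemma h17adj_mem {F : Set A} (hF : IsRLFilter F) (a : A) : a ∈ h17adj F a :=
  ⟨1, h17_top_mem hF, 1, by simp⟩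

lemma h17_zorn (J F : Set A) (hF : IsRLFilter F) (hJ : Disjoint F J)
    (hJs : ∀ a ∈ J, ∀ b ∈ J, a ⊔ b ∈ J) :
    ∃ P : Set A, F ⊆ P ∧ IsRLFilter P ∧ Disjoint P J ∧
      (∀ G, IsRLFilter G → Disjoint G J → P ⊆ G → G = P) ∧
      ∀ a b : A, a ⊔ b ∈ P → a ∈ P ∨ b ∈ P := by
  obtain ⟨P, hFP, hP⟩ := zorn_subset_nonempty {G : Set A | IsRLFilter G ∧ Disjoint G J} (by
    intro c hc hch hne
    refine ⟨⋃₀ c, ⟨⟨?_, ?_, ?_⟩, ?_⟩, fun s hs => Set.subset_sUnion_of_mem hs⟩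
    · obtain ⟨s, hs⟩ := hne
      exact ⟨1, s, hs, h17_top_mem (hc hs).1⟩
    · rintro a b ⟨s, hs, ha⟩ ⟨t, ht, hb⟩
      rcases hch.total hs ht with h | h
      · exact ⟨t, ht, (hc ht).1.2.1 _ _ (h ha) hb⟩
      · exact ⟨s, hs, (hc hs).1.2.1 _ _ ha (h hb)⟩
    · rintro a b ⟨s, hs, ha⟩ hab
      exact ⟨s, hs, (hc hs).1.2.2 _ _ ha hab⟩
    · rw [Set.disjoint_sUnion_left]
      exact fun s hs => (hc hs).2) F ⟨hF, hJ⟩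
  have hmax : ∀ G, IsRLFilter G → Disjoint G J → P ⊆ G → G = P := fun G h1 h2 h3 =>
    (hP.eq_of_subset ⟨h1, h2⟩ h3).symm
  have hPF := hP.prop.1
  refine ⟨P, hFP, hPF, hP.prop.2, hmax, ?_⟩
  intro a b hab
  by_contra! hcon
  have key : ∀ x, x ∉ P → ∃ j ∈ J, ∃ p ∈ P, ∃ n : ℕ, p * x ^ n ≤ j := by
    intro x hx
    by_contra! hne
    have := hmax _ (h17adj_filter hPF x) (by
      rw [Set.disjoint_left]
      rintro z ⟨p, hp, n, h⟩ hz
      exact hne z hz p hp n h) (h17adj_sub x)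
    exact hx (this ▸ h17adj_mem hPF x)
  obtain ⟨j, hj, p, hp, n, h⟩ := key a hcon.1
  obtain ⟨k, hk, q, hq, m, h'⟩ := key b hcon.2
  have h3 := h17_pow a b (j ⊔ k) n m (p * q)
    (((h17_mul_right _ (h17_mul_le_left p q)).trans h).trans le_sup_left)
    (((h17_mul_right _ (h17_mul_le_right p q)).trans h').trans le_sup_right)
  exact Set.disjoint_left.1 hP.prop.2 (hPF.2.2 _ _
    (hPF.2.1 _ _ (hPF.2.1 _ _ hp hq) (h17_pow_mem hPF hab _)) h3) (hJs _ hj _ hk)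

lemma h17_exists_max {F : Set A} (hF : IsRLFilter F) (hb : ⊥ ∉ F) :
    ∃ M, IsMaxRLFilter M ∧ F ⊆ M := by
  obtain ⟨P, h1, h2, h3, h4, -⟩ := h17_zorn {⊥} F hF (by simpa using hb) (by simp)
  refine ⟨P, ⟨⟨h2, (h17_proper h2).2 (by simpa using h3)⟩, fun G hG hPG => ?_⟩, h1⟩
  exact h4 G hG.1 (by simpa using (h17_proper hG.1).1 hG.2) hPG

lemma h17_max_bot {M : Set A} (hM : IsMaxRLFilter M) : ⊥ ∉ M := (h17_proper hM.1.1).1 hM.1.2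

lemma h17_max_prime {M : Set A} (hM : IsMaxRLFilter M) {a b : A} (h : a ⊔ b ∈ M) :
    a ∈ M ∨ b ∈ M := by
  obtain ⟨P, h1, h2, h3, h4, h5⟩ := h17_zorn {⊥} M hM.1.1 (by simpa using h17_max_bot hM) (by simp)
  have : P = M := hM.2 P ⟨h2, (h17_proper h2).2 (by simpa using h3)⟩ h1
  subst this
  exact h5 a b h

lemma h17_sep (hG : ∀ P : Set A, IsPrimeRLFilter P → ∃! M : Set A, IsMaxRLFilter M ∧ P ⊆ M)
    {M N : Set A} (hM : IsMaxRLFilter M) (hN : IsMaxRLFilter N) (hne : M ≠ N) :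
    ∃ x y : A, x ∉ M ∧ y ∉ N ∧ x ⊔ y = 1 := by
  by_contra! hcon
  have hone : IsRLFilter ({1} : Set A) := by
    refine ⟨⟨1, rfl⟩, ?_, ?_⟩
    · rintro a b rfl rfl; simp
    · rintro a b rfl h; exact le_antisymm (h17_le_one b) h
  obtain ⟨P, -, h2, h3, -, h5⟩ := h17_zorn {z | ∃ x y : A, x ∉ M ∧ y ∉ N ∧ x ⊔ y = z} {1} hone
    (by
      rw [Set.disjoint_singleton_left]
      rintro ⟨x, y, hx, hy, h⟩
      exact hcon x y hx hy h)
    (by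
      rintro _ ⟨x, y, hx, hy, rfl⟩ _ ⟨x', y', hx', hy', rfl⟩
      exact ⟨x ⊔ x', y ⊔ y', fun h => (h17_max_prime hM h).elim hx hx',
        fun h => (h17_max_prime hN h).elim hy hy', sup_sup_sup_comm _ _ _ _⟩)
  have hd := fun x (hx : x ∈ P) => Set.disjoint_left.1 h3 hx
  have hPM : P ⊆ M := fun x hx => by
    by_contra h
    exact hd x hx ⟨x, ⊥, h, h17_max_bot hN, by simp⟩
  have hPN : P ⊆ N := fun x hx => by
    by_contra h
    exact hd x hx ⟨⊥, x, h17_max_bot hM, h, by simp⟩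
  have hPp : IsPrimeRLFilter P :=
    ⟨⟨h2, (h17_proper h2).2 fun h => h17_max_bot hM (hPM h)⟩, h5⟩
  exact hne ((hG P hPp).unique ⟨hM, hPM⟩ ⟨hN, hPN⟩)

lemma h17_sup_mul {x x' y y' : A} (h : x ⊔ y = 1) (h' : x' ⊔ y' = 1) :
    (x * x') ⊔ (y ⊔ y') = 1 := by
  apply le_antisymm (h17_le_one _)
  have : (x ⊔ y) * (x' ⊔ y') ≤ (x * x') ⊔ (y ⊔ y') := by
    apply h17_mul_sup
    · rw [mul_comm]
      apply h17_mul_sup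
      · rw [mul_comm]; exact le_sup_left
      · exact (h17_mul_le_right _ _).trans (le_sup_left.trans le_sup_right)
    · exact (h17_mul_le_right _ _).trans (le_sup_right.trans le_sup_right)
  simpa [h, h'] using this

lemma h17_neg (a : A) : a * rneg a ≤ ⊥ := by
  rw [mul_comm]; exact (residuation _ _ _).1 le_rfl

lemma h17_le_imp (a b : A) : b ≤ rimp a b := (residuation _ _ _).2 (h17_mul_le_left _ _)

lemma h17_not_both {M : Set A} (hM : IsMaxRLFilter M) {a b : A} {k : ℕ} (h : a * b ^ k ≤ ⊥)
    (ha : a ∈ M) (hb : b ∈ M) : False :=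
  h17_max_bot hM (hM.1.1.2.2 _ _ (hM.1.1.2.1 _ _ ha (h17_pow_mem hM.1.1 hb k)) h)

end helpers

end ResiduatedLattice

open ResiduatedLattice in
theorem stmt_17 {A : Type*} [ResiduatedLattice A]
    (hGelfand : ∀ P : Set A, IsPrimeRLFilter P →
      ∃! M : Set A, IsMaxRLFilter M ∧ P ⊆ M) :
    HasBLP (rad A) := by
  intro a ha
  have hneg : ∀ M : Set A, IsMaxRLFilter M → a ∈ M → rneg a ∈ M → False := fun M hM h1 h2 =>
    h17_not_both hM (k := 1) (by simpa using h17_neg a) h1 h2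
  have hor : ∀ M : Set A, IsMaxRLFilter M → a ∈ M ∨ rneg a ∈ M := fun M hM =>
    h17_max_prime hM (ha M hM)
  -- first compactness step
  have step1 : ∀ M : Set A, IsMaxRLFilter M → a ∈ M →
      ∃ x y : A, x ∉ M ∧ x ⊔ y = 1 ∧ ∃ k : ℕ, y * rneg a ^ k ≤ ⊥ := by
    intro M hM haM
    have hGf : IsRLFilter {y : A | ∃ x : A, x ∉ M ∧ x ⊔ y = 1} := by
      refine ⟨⟨1, ⊥, h17_max_bot hM, by simp⟩, ?_, ?_⟩
      · rintro y y' ⟨x, hx, h⟩ ⟨x', hx', h'⟩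
        refine ⟨x ⊔ x', fun h => (h17_max_prime hM h).elim hx hx', ?_⟩
        rw [sup_comm]
        exact h17_sup_mul (by rwa [sup_comm]) (by rwa [sup_comm])
      · rintro y y' ⟨x, hx, h⟩ hy
        exact ⟨x, hx, le_antisymm (h17_le_one _) (h ▸ sup_le_sup_left hy x)⟩
    by_contra hcon
    obtain ⟨N, hN, hsub⟩ := h17_exists_max (h17adj_filter hGf (rneg a)) (by
      rintro ⟨y, ⟨x, hx, h⟩, k, hk⟩
      exact hcon ⟨x, y, hx, h, k, hk⟩)
    have hnN : rneg a ∈ N := hsub (h17adj_mem hGf _)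
    obtain ⟨x, y, hx, hy, h⟩ := h17_sep hGelfand hM hN (by
      rintro rfl
      exact hneg M hM haM hnN)
    exact hy (hsub (h17adj_sub _ ⟨x, hx, h⟩))
  -- second compactness step
  have step2 : ∃ x y : A, x ⊔ y = 1 ∧ (∃ k : ℕ, y * rneg a ^ k ≤ ⊥) ∧
      ∃ j : ℕ, x * a ^ j ≤ ⊥ := by
    have hHf : IsRLFilter {x : A | ∃ y : A, x ⊔ y = 1 ∧ ∃ k : ℕ, y * rneg a ^ k ≤ ⊥} := by
      refine ⟨⟨1, ⊥, by simp [one_eq_top], 0, by simp⟩, ?_, ?_⟩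
      · rintro x x' ⟨y, h, k, hk⟩ ⟨y', h', k', hk'⟩
        refine ⟨y ⊔ y', h17_sup_mul h h', k + k', ?_⟩
        rw [mul_comm]
        apply h17_mul_sup
        · rw [mul_comm, pow_add, ← mul_assoc]
          exact (h17_mul_le_left _ _).trans hk
        · rw [mul_comm, add_comm, pow_add, ← mul_assoc]
          exact (h17_mul_le_left _ _).trans hk'
      · rintro x x' ⟨y, h, hk⟩ hx
        exact ⟨y, le_antisymm (h17_le_one _) (h ▸ sup_le_sup_right hx y), hk⟩
    by_contra hcon
    obtain ⟨M, hM, hsub⟩ := h17_exists_max (h17adj_filter hHf a) (by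
      rintro ⟨x, ⟨y, h, hk⟩, j, hj⟩
      exact hcon ⟨x, y, h, hk, j, hj⟩)
    obtain ⟨x, y, hx, h, hk⟩ := step1 M hM (hsub (h17adj_mem hHf _))
    exact hx (hsub (h17adj_sub _ ⟨y, h, hk⟩))
  obtain ⟨x, y, hxy, ⟨k, hk⟩, j, hj⟩ := step2
  have hone : IsRLFilter ({1} : Set A) := by
    refine ⟨⟨1, rfl⟩, ?_, ?_⟩
    · rintro a b rfl rfl; simp
    · rintro a b rfl h; exact le_antisymm (h17_le_one b) h
  have hnil : ∃ n : ℕ, (x * y) ^ n ≤ ⊥ := by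
    by_contra hcon
    obtain ⟨M, hM, hsub⟩ := h17_exists_max (h17adj_filter hone (x * y)) (by
      rintro ⟨p, rfl, n, h⟩
      exact hcon ⟨n, by simpa using h⟩)
    have hm := hsub (h17adj_mem hone _)
    have hxM : x ∈ M := hM.1.1.2.2 _ _ hm (h17_mul_le_left _ _)
    have hyM : y ∈ M := hM.1.1.2.2 _ _ hm (h17_mul_le_right _ _)
    rcases hor M hM with h | h
    · exact h17_not_both hM hj hxM h
    · exact h17_not_both hM hk hyM h
  obtain ⟨n, hn⟩ := hnil
  rw [mul_pow] at hn
  have hsup : y ^ n ⊔ x ^ n = 1 := by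
    apply le_antisymm (h17_le_one _)
    have := h17_pow y x (y ^ n ⊔ x ^ n) n n 1 (by simp) (by simp)
    rw [sup_comm y x, hxy] at this
    simpa using this
  refine ⟨y ^ n, ⟨x ^ n, by rw [hsup, one_eq_top], ?_⟩, ?_⟩
  · apply le_antisymm _ bot_le
    have : (y ^ n ⊓ x ^ n) * (y ^ n ⊔ x ^ n) ≤ ⊥ := by
      apply h17_mul_sup
      · exact (h17_mul_right _ inf_le_right).trans hn
      · rw [mul_comm]
        exact (h17_mul le_rfl inf_le_left).trans hn
    simpa [hsup] using this
  · intro M hM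
    have hMf := hM.1.1
    have hxyM : x ∈ M ∨ y ∈ M := h17_max_prime hM (hxy ▸ h17_top_mem hMf)
    have key : ∀ u v : A, u ∈ M → v ∈ M → u ⊓ v ∈ M := fun u v hu hv =>
      hMf.2.2 _ _ (hMf.2.1 _ _ hu hv) (le_inf (h17_mul_le_left _ _) (h17_mul_le_right _ _))
    rcases hor M hM with h | h
    · have hy : y ∈ M := hxyM.resolve_left fun hx => h17_not_both hM hj hx h
      exact key _ _ (hMf.2.2 _ _ (h17_pow_mem hMf hy n) (h17_le_imp _ _))
        (hMf.2.2 _ _ h (h17_le_imp _ _))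
    · have hx : x ∈ M := hxyM.resolve_right fun hy => h17_not_both hM hk hy h
      refine key _ _ (hMf.2.2 _ _ h ?_) (hMf.2.2 _ _ (h17_pow_mem hMf hx n) ?_)
      · refine (residuation _ _ _).2 (le_trans ?_ bot_le)
        rw [mul_comm]; exact h17_neg a
      · exact (residuation _ _ _).2 (hn.trans bot_le)
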